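/- There exists c > 0 such that for every T > 0 there exists a solution X of the time-delay system (S_c) with initial segment satisfying ‖X0‖ ≤ 2 and with |X(T)| ≥ 1. Consequently, the origin of (S_c) is not uniformly globally attractive: the time needed for solutions starting in the ball of radius 2 to enter the ball of radius 1 cannot be bounded uniformly. -/

import Mathlib

open Set Matrix

/-- The matrix `A0`. -/
noncomputable def A0 : Matrix (Fin 2) (Fin 2) ℝ := !![-0.1, 0.5; -2, 0]

/-- The matrix `A1`. -/
noncomputable def A1 : Matrix (Fin 2) (Fin 2) ℝ := !![0, 2; -0.5, -0.1]

/-- The saturation function `φ`. -/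
noncomputable def phi (s : ℝ) : ℝ := if s < 0 then 0 else if s ≤ 1 then s else 1

/-- `ℝ²` with the Euclidean norm. -/
abbrev E2 : Type := EuclideanSpace ℝ (Fin 2)

/-- Action of a `2 × 2` matrix on `ℝ²`. -/
noncomputable def act (A : Matrix (Fin 2) (Fin 2) ℝ) (x : E2) : E2 :=
  Matrix.toEuclideanLin A x

/-- The nonlinearity `g(x,u) = (1+|x|²)(φ(u) A1 + (1-φ(u)) A0) x`. -/
noncomputable def gfun (x : E2) (u : ℝ) : E2 :=
  (1 + ‖x‖ ^ 2) • act (phi u • A1 + (1 - phi u) • A0) x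

/-- `X = (x, z1, z2) : [-2,∞) → ℝ² × ℝ × ℝ` is a solution of the time-delay system `(S_c)`. -/
def IsSolution (c : ℝ) (x : ℝ → E2) (z1 z2 : ℝ → ℝ) : Prop :=
  ContinuousOn x (Ici (-2 : ℝ)) ∧ ContinuousOn z1 (Ici (-2 : ℝ)) ∧
  ContinuousOn z2 (Ici (-2 : ℝ)) ∧
  ∀ t : ℝ, 0 < t →
    HasDerivAt x ((c * phi (z2 (t - 2))) • gfun (x t) (z1 (t - 1))
      + (c * (1 - phi (z2 (t - 2)))) • act A0 (x t)) t
    ∧ HasDerivAt z1 (-(z1 t)) t ∧ HasDerivAt z2 (-(z2 t)) t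

/-- Euclidean norm `|X(t)|` of the full state `(x(t), z1(t), z2(t)) ∈ ℝ⁴`. -/
noncomputable def Xnorm (x : ℝ → E2) (z1 z2 : ℝ → ℝ) (t : ℝ) : ℝ :=
  Real.sqrt (‖x t‖ ^ 2 + (z1 t) ^ 2 + (z2 t) ^ 2)

/-- Norm `‖X0‖ = sup_{τ ∈ [-2,0]} |X(τ)|` of the initial segment of a solution. -/
noncomputable def initNorm (x : ℝ → E2) (z1 z2 : ℝ → ℝ) : ℝ :=
  sSup (Xnorm x z1 z2 '' Icc (-2 : ℝ) 0)

theorem sub_le_sub_of_hasDerivAt_le {f g df dg : ℝ → ℝ} {a b : ℝ} (hab : a ≤ b)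
    (hf : ∀ s ∈ Icc a b, HasDerivAt f (df s) s) (hg : ∀ s ∈ Icc a b, HasDerivAt g (dg s) s)
    (hle : ∀ s ∈ Icc a b, df s ≤ dg s) : f b - f a ≤ g b - g a := by
  have hmono : MonotoneOn (fun s => g s - f s) (Icc a b) := by
    refine monotoneOn_of_hasDerivWithinAt_nonneg (f' := fun s => dg s - df s) (convex_Icc a b)
      (fun s hs => ((hg s hs).sub (hf s hs)).continuousAt.continuousWithinAt)
      (fun s hs => ((hg s (interior_subset hs)).sub (hf s (interior_subset hs))).hasDerivWithinAt)
      fun s hs => sub_nonneg.2 (hle s (interior_subset hs))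
  have := hmono (left_mem_Icc.2 hab) (right_mem_Icc.2 hab) hab
  simp only at this
  linarith

/-- A strictly positive, continuous clock rate that is bounded below near `±∞` defines a global
time change. -/
theorem exists_time_change {τ h : ℝ → ℝ} (hτ : ∀ s, HasDerivAt τ (h s) s) (hpos : ∀ s, 0 < h s)
    {ε a b : ℝ} (hε : 0 < ε) (ha : ∀ s ≤ a, ε ≤ h s) (hb : ∀ s, b ≤ s → ε ≤ h s) :
    ∃ σ : ℝ → ℝ, StrictMono σ ∧ (∀ t, HasDerivAt σ (h (σ t))⁻¹ t) ∧
      (∀ t, τ (σ t) = t) ∧ ∀ s, σ (τ s) = s := by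
  have hmono : StrictMono τ := strictMono_of_hasDerivAt_pos hτ hpos
  have hcont : Continuous τ := continuous_iff_continuousAt.2 fun s => (hτ s).continuousAt
  have hid : ∀ s, HasDerivAt (fun s : ℝ => ε * s) ε s := fun s => by
    simpa using (hasDerivAt_id s).const_mul ε
  have hsurj : Function.Surjective τ := by
    refine hcont.surjective ?_ ?_
    · refine Filter.tendsto_atTop_mono' _ (f₁ := fun s => τ b - ε * b + ε * s) ?_ ?_
      · filter_upwards [Filter.eventually_ge_atTop b] with s hs
        have := sub_le_sub_of_hasDerivAt_le hs (fun s _ => hid s) (fun s _ => hτ s)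
          (fun s h => hb s h.1)
        linarith
      · exact Filter.tendsto_atTop_add_const_left _ _ (Filter.tendsto_id.const_mul_atTop hε)
    · refine Filter.tendsto_atBot_mono' _ (f₁ := fun s => τ a - ε * a + ε * s) ?_ ?_
      · filter_upwards [Filter.eventually_le_atBot a] with s hs
        have := sub_le_sub_of_hasDerivAt_le hs (fun s _ => hid s) (fun s _ => hτ s)
          (fun s h => ha s h.2)
        linarith
      · exact Filter.tendsto_atBot_add_const_left _ _ (Filter.tendsto_id.const_mul_atBot hε)
  let e := hmono.orderIsoOfSurjective τ hsurj
  have he : ∀ t, τ (e.symm t) = t := fun t => e.apply_symm_apply t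
  refine ⟨e.symm, e.symm.strictMono, fun t => ?_, he, fun s => e.symm_apply_apply s⟩
  exact HasDerivAt.of_local_left_inverse e.symm.continuous.continuousAt (hτ _) (hpos _).ne'
    (Filter.Eventually.of_forall he)

theorem phi_nonneg (s : ℝ) : 0 ≤ phi s := by
  unfold phi; split_ifs <;> linarith

theorem phi_le_one (s : ℝ) : phi s ≤ 1 := by
  unfold phi; split_ifs <;> linarith

theorem phi_of_mem {s : ℝ} (h0 : 0 ≤ s) (h1 : s ≤ 1) : phi s = s := by
  rw [phi, if_neg h0.not_gt, if_pos h1]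

theorem phi_of_nonpos {s : ℝ} (h : s ≤ 0) : phi s = 0 := by
  unfold phi; split_ifs <;> linarith

theorem phi_of_one_le {s : ℝ} (h : 1 ≤ s) : phi s = 1 := by
  unfold phi; split_ifs <;> linarith

theorem continuous_phi : Continuous phi := by
  have : phi = fun s => max 0 (min s 1) := by
    funext s
    unfold phi
    split_ifs with h hh
    · rw [max_eq_left ((min_le_left _ _).trans h.le)]
    · rw [min_eq_left hh, max_eq_right (not_lt.1 h)]
    · rw [min_eq_right (not_le.1 hh).le, max_eq_right zero_le_one]
  rw [this]
  fun_prop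

/-- Radial growth rate of `(w A1 + (1 - w) A0) x` in the direction `(cos s, -sin s)`. -/
noncomputable def radialRate (w s : ℝ) : ℝ :=
  w * (-1.5 * (Real.cos s * Real.sin s) - 0.1 * Real.sin s ^ 2) +
    (1 - w) * (1.5 * (Real.cos s * Real.sin s) - 0.1 * Real.cos s ^ 2)

/-- Clockwise angular speed of `(w A1 + (1 - w) A0) x` in the direction `(cos s, -sin s)`. -/
noncomputable def angularRate (w s : ℝ) : ℝ :=
  w * (0.5 * Real.cos s ^ 2 - 0.1 * (Real.cos s * Real.sin s) + 2 * Real.sin s ^ 2) +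
    (1 - w) * (2 * Real.cos s ^ 2 + 0.1 * (Real.cos s * Real.sin s) + 0.5 * Real.sin s ^ 2)

theorem angularRate_ge {w s : ℝ} (h0 : 0 ≤ w) (h1 : w ≤ 1) : 0.4 ≤ angularRate w s := by
  unfold angularRate
  have hs := Real.sin_sq_add_cos_sq s
  have ha : 0.4 ≤ 0.5 * Real.cos s ^ 2 - 0.1 * (Real.cos s * Real.sin s) + 2 * Real.sin s ^ 2 := by
    nlinarith [sq_nonneg (Real.cos s - Real.sin s), sq_nonneg (Real.sin s)]
  have hb : 0.4 ≤ 2 * Real.cos s ^ 2 + 0.1 * (Real.cos s * Real.sin s) + 0.5 * Real.sin s ^ 2 := by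
    nlinarith [sq_nonneg (Real.cos s + Real.sin s), sq_nonneg (Real.cos s)]
  nlinarith

theorem angularRate_le {w s : ℝ} (h0 : 0 ≤ w) (h1 : w ≤ 1) : angularRate w s ≤ 3 := by
  unfold angularRate
  have hs := Real.sin_sq_add_cos_sq s
  have ha : 0.5 * Real.cos s ^ 2 - 0.1 * (Real.cos s * Real.sin s) + 2 * Real.sin s ^ 2 ≤ 3 := by
    nlinarith [sq_nonneg (Real.cos s + Real.sin s), sq_nonneg (Real.cos s)]
  have hb : 2 * Real.cos s ^ 2 + 0.1 * (Real.cos s * Real.sin s) + 0.5 * Real.sin s ^ 2 ≤ 3 := by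
    nlinarith [sq_nonneg (Real.cos s - Real.sin s), sq_nonneg (Real.sin s)]
  nlinarith

theorem radialRate_ge {w s : ℝ} (h0 : 0 ≤ w) (h1 : w ≤ 1) : -1 ≤ radialRate w s := by
  unfold radialRate
  have hs := Real.sin_sq_add_cos_sq s
  have ha : -1 ≤ -1.5 * (Real.cos s * Real.sin s) - 0.1 * Real.sin s ^ 2 := by
    nlinarith [sq_nonneg (Real.cos s - Real.sin s), sq_nonneg (Real.cos s)]
  have hb : -1 ≤ 1.5 * (Real.cos s * Real.sin s) - 0.1 * Real.cos s ^ 2 := by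
    nlinarith [sq_nonneg (Real.cos s + Real.sin s), sq_nonneg (Real.sin s)]
  nlinarith

theorem neg_three_le_radialRate_div {w s : ℝ} (h0 : 0 ≤ w) (h1 : w ≤ 1) :
    -3 ≤ radialRate w s / angularRate w s := by
  have ha := angularRate_ge (s := s) h0 h1
  rw [le_div_iff₀ (by linarith)]
  linarith [radialRate_ge (s := s) h0 h1]

/-- With the feedback `w = (1 - sin 2s) / 2` the state grows on average. -/
theorem growth_le_radialRate_div (s : ℝ) :
    0.13 - 0.22 * Real.cos (4 * s) ≤ radialRate ((1 - Real.sin (2 * s)) / 2) s /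
      angularRate ((1 - Real.sin (2 * s)) / 2) s := by
  have hr : radialRate ((1 - Real.sin (2 * s)) / 2) s =
      0.75 * Real.sin (2 * s) ^ 2 - 0.05 - 0.05 * (Real.sin (2 * s) * Real.cos (2 * s)) := by
    unfold radialRate
    have := Real.sin_sq_add_cos_sq s
    rw [Real.cos_two_mul', Real.sin_two_mul]
    linear_combination (-0.05) * this
  have ha : angularRate ((1 - Real.sin (2 * s)) / 2) s =
      1.25 + 0.75 * (Real.sin (2 * s) * Real.cos (2 * s)) + 0.05 * Real.sin (2 * s) ^ 2 := by
    unfold angularRate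
    have := Real.sin_sq_add_cos_sq s
    rw [Real.cos_two_mul', Real.sin_two_mul]
    linear_combination 1.25 * this
  have h4 : Real.cos (4 * s) = 1 - 2 * Real.sin (2 * s) ^ 2 := by
    rw [show 4 * s = 2 * (2 * s) by ring, Real.cos_two_mul, Real.cos_sq']
    ring
  rw [hr, ha, h4]
  have hs := Real.sin_sq_add_cos_sq (2 * s)
  generalize Real.sin (2 * s) = S at *
  generalize Real.cos (2 * s) = C at *
  have hlo : -(1 / 2) ≤ S * C := by nlinarith [sq_nonneg (S + C)]
  have hhi : S * C ≤ 1 / 2 := by nlinarith [sq_nonneg (S - C)]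
  have hS : S ^ 2 ≤ 1 := by nlinarith
  rw [le_div_iff₀ (by nlinarith)]
  nlinarith [sq_nonneg S, mul_nonneg (sq_nonneg S) (sub_nonneg.2 hhi),
    mul_nonneg (sq_nonneg S) (sub_nonneg.2 hS)]

/-- The plane curve with logarithmic radius `ρ` that runs clockwise with unit angular speed. -/
noncomputable def spiral (ρ : ℝ → ℝ) (s : ℝ) : E2 :=
  WithLp.toLp 2 ![Real.exp (ρ s) * Real.cos s, -(Real.exp (ρ s) * Real.sin s)]

theorem norm_spiral_sq (ρ : ℝ → ℝ) (s : ℝ) : ‖spiral ρ s‖ ^ 2 = Real.exp (2 * ρ s) := by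
  rw [EuclideanSpace.norm_sq_eq, Fin.sum_univ_two, two_mul, Real.exp_add]
  simp only [spiral, cons_val_zero, cons_val_one, Real.norm_eq_abs, sq_abs]
  linear_combination Real.exp (ρ s) ^ 2 * Real.sin_sq_add_cos_sq s

theorem hasDerivAt_spiral {ρ : ℝ → ℝ} {s w : ℝ} (hω : angularRate w s ≠ 0)
    (hρ : HasDerivAt ρ (radialRate w s / angularRate w s) s) :
    HasDerivAt (spiral ρ) ((angularRate w s)⁻¹ • act (w • A1 + (1 - w) • A0) (spiral ρ s)) s := by
  have hpi : HasDerivAt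
      (fun s => ![Real.exp (ρ s) * Real.cos s, -(Real.exp (ρ s) * Real.sin s)])
      ![Real.exp (ρ s) * (radialRate w s / angularRate w s) * Real.cos s +
          Real.exp (ρ s) * -Real.sin s,
        -(Real.exp (ρ s) * (radialRate w s / angularRate w s) * Real.sin s +
          Real.exp (ρ s) * Real.cos s)] s := by
    refine hasDerivAt_pi.2 fun i => ?_
    fin_cases i
    · exact hρ.exp.mul (Real.hasDerivAt_cos s)
    · exact (hρ.exp.mul (Real.hasDerivAt_sin s)).neg
  have hsp := (PiLp.hasFDerivAt_toLp (𝕜 := ℝ) 2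
    ![Real.exp (ρ s) * Real.cos s, -(Real.exp (ρ s) * Real.sin s)]).comp_hasDerivAt s hpi
  have hsc := Real.sin_sq_add_cos_sq s
  refine hsp.congr_deriv ?_
  ext i
  fin_cases i
  · simp [act, spiral, A0, A1, Matrix.toLpLin_apply]
    field_simp
    unfold angularRate radialRate
    linear_combination (w * (-2 * Real.sin s) + (1 - w) * (-0.1 * Real.cos s - 0.5 * Real.sin s)) * hsc
  · simp [act, spiral, A0, A1, Matrix.toLpLin_apply]
    field_simp
    unfold angularRate radialRate
    linear_combination (w * (-0.5 * Real.cos s + 0.1 * Real.sin s) + (1 - w) * (-2 * Real.cos s)) * hsc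

theorem continuous_radialRate {W : ℝ → ℝ} (hW : Continuous W) :
    Continuous fun s => radialRate (W s) s := by
  unfold radialRate; fun_prop

theorem continuous_angularRate {W : ℝ → ℝ} (hW : Continuous W) :
    Continuous fun s => angularRate (W s) s := by
  unfold angularRate; fun_prop

/-- The speed at which the solution runs through the spiral with logarithmic radius `ρ`, when the
switching weight is `W` and the amplification weight is `V`. -/
noncomputable def spiralSpeed (c : ℝ) (W V ρ : ℝ → ℝ) (s : ℝ) : ℝ :=
  c * angularRate (W s) s * (1 + V s * Real.exp (2 * ρ s))

/-- A spiral whose controls are functions of the angle, run through with the appropriate speed,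
solves the time-delay system. -/
theorem exists_solution_of_spiral {c b : ℝ} {W V ρ τ : ℝ → ℝ} (hc : 0 < c)
    (hWc : Continuous W) (hVc : Continuous V) (hW0 : ∀ s, 0 ≤ W s) (hW1 : ∀ s, W s ≤ 1)
    (hV0 : ∀ s, 0 ≤ V s) (hV1 : ∀ s, V s ≤ 1) (hVW : ∀ s, V s = 1 ∨ W s = 0)
    (hWb : ∀ s, b ≤ s → W s = 0) (hVb : ∀ s, b ≤ s → V s = 0)
    (hρ : ∀ s, HasDerivAt ρ (radialRate (W s) s / angularRate (W s) s) s)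
    (hρ0 : Real.exp (2 * ρ 0) ≤ 2) (hτ0 : τ 0 = 0)
    (hτ : ∀ s, HasDerivAt τ (spiralSpeed c W V ρ (max s 0))⁻¹ s) (hτb : τ b ≤ 1) :
    ∃ (x : ℝ → E2) (z1 z2 : ℝ → ℝ), IsSolution c x z1 z2 ∧ initNorm x z1 z2 ≤ 2 ∧
      ∀ T, 0 < T → ∃ s, 0 ≤ s ∧ τ s = T ∧ ‖x T‖ ^ 2 = Real.exp (2 * ρ s) := by
  have hω : ∀ s, 0 < angularRate (W s) s := fun s => by
    linarith [angularRate_ge (s := s) (hW0 s) (hW1 s)]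
  have hpos : ∀ s, 0 < spiralSpeed c W V ρ s := fun s => by
    have := hω s
    have := hV0 s
    unfold spiralSpeed
    positivity
  have hend : ∀ s, b ≤ s → spiralSpeed c W V ρ s ≤ c * 3 := fun s hs => by
    rw [spiralSpeed, hVb s hs, zero_mul, add_zero, mul_one]
    exact mul_le_mul_of_nonneg_left (angularRate_le (hW0 s) (hW1 s)) hc.le
  obtain ⟨σ, hmono, hσ, hτσ, hστ⟩ := exists_time_change (a := 0) (b := b)
    (ε := min (spiralSpeed c W V ρ 0)⁻¹ (c * 3)⁻¹) hτ (fun s => inv_pos.2 (hpos _))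
    (lt_min (inv_pos.2 (hpos _)) (by positivity))
    (fun s hs => by rw [max_eq_right hs]; exact min_le_left _ _)
    (fun s hs => (min_le_right _ _).trans
      (inv_anti₀ (hpos _) (hend _ (hs.trans (le_max_left _ _)))))
  have hσ0 : σ 0 = 0 := by rw [← hτ0, hστ, hτ0]
  have hσc : Continuous σ := continuous_iff_continuousAt.2 fun t => (hσ t).continuousAt
  have hbσ : ∀ t, 1 ≤ t → b ≤ σ t := fun t ht => by
    rw [← hστ b]
    exact hmono.monotone (hτb.trans ht)
  have hspc : Continuous (spiral ρ) := continuous_iff_continuousAt.2 fun s =>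
    (hasDerivAt_spiral (hω s).ne' (hρ s)).continuousAt
  have hvanish : ∀ (U : ℝ → ℝ) (d : ℝ), 1 ≤ d → (∀ s, b ≤ s → U s = 0) → ∀ t : ℝ, 0 < t →
      HasDerivAt (fun t => U (σ (t + d))) (-U (σ (t + d))) t := fun U d hd hU t ht => by
    rw [hU _ (hbσ _ (by linarith)), neg_zero]
    refine (hasDerivAt_const t (0 : ℝ)).congr_of_eventuallyEq ?_
    filter_upwards [lt_mem_nhds ht] with r hr
    exact hU _ (hbσ _ (by linarith))
  refine ⟨fun t => spiral ρ (σ (max t 0)), fun t => W (σ (t + 1)), fun t => V (σ (t + 2)),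
    ⟨?_, ?_, ?_, fun t ht => ⟨?_, hvanish W 1 le_rfl hWb t ht,
      hvanish V 2 (by norm_num) hVb t ht⟩⟩, ?_, fun T hT => ⟨σ T, ?_, hτσ T, ?_⟩⟩
  · exact (hspc.comp (hσc.comp (by fun_prop))).continuousOn
  · exact (hWc.comp (hσc.comp (by fun_prop))).continuousOn
  · exact (hVc.comp (hσc.comp (by fun_prop))).continuousOn
  · have hσt : 0 < σ t := hσ0 ▸ hmono ht
    have hd := (hasDerivAt_spiral (hω (σ t)).ne' (hρ (σ t))).scomp t (hσ t)
    have heq : (fun t => spiral ρ (σ (max t 0))) =ᶠ[nhds t] spiral ρ ∘ σ := by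
      filter_upwards [lt_mem_nhds ht] with r hr
      simp only [Function.comp, max_eq_left hr.le]
    refine (hd.congr_of_eventuallyEq heq).congr_deriv ?_
    simp only [sub_add_cancel, max_eq_left ht.le, max_eq_left hσt.le, inv_inv, gfun,
      phi_of_mem (hV0 _) (hV1 _), phi_of_mem (hW0 _) (hW1 _), norm_spiral_sq, smul_smul]
    have hcancel : spiralSpeed c W V ρ (σ t) * (angularRate (W (σ t)) (σ t))⁻¹ =
        c * (1 + V (σ t) * Real.exp (2 * ρ (σ t))) := by
      have := (hω (σ t)).ne'
      unfold spiralSpeed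
      field_simp
    rw [hcancel]
    rcases hVW (σ t) with h | h
    · simp [h]
    · simp only [h, zero_smul, zero_add, sub_zero, one_smul, ← add_smul]
      congr 1
      ring
  · refine csSup_le ((nonempty_Icc.2 (by norm_num)).image _) ?_
    rintro _ ⟨t, ht, rfl⟩
    rw [Xnorm]
    simp only [max_eq_right ht.2, hσ0, norm_spiral_sq]
    refine Real.sqrt_le_iff.2 ⟨by norm_num, ?_⟩
    have h1 := pow_le_one₀ (n := 2) (hW0 (σ (t + 1))) (hW1 (σ (t + 1)))
    have h2 := pow_le_one₀ (n := 2) (hV0 (σ (t + 2))) (hV1 (σ (t + 2)))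
    linarith
  · exact hσ0 ▸ hmono.monotone hT.le
  · simp only [max_eq_left hT.le, norm_spiral_sq]

theorem hasDerivAt_integral_of_continuous {f : ℝ → ℝ} (hf : Continuous f) (a s : ℝ) :
    HasDerivAt (fun s => ∫ r in a..s, f r) (f s) s :=
  intervalIntegral.integral_hasDerivAt_right (hf.intervalIntegrable _ _)
    hf.aestronglyMeasurable.stronglyMeasurableAtFilter hf.continuousAt

/-- `(S_c)` is not uniformly globally attractive: there is `c > 0` such that for every
`T > 0` some solution with `‖X0‖ ≤ 2` satisfies `|X(T)| ≥ 1`. -/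
theorem stmt_10 :
    ∃ c : ℝ, 0 < c ∧ ∀ T : ℝ, 0 < T →
      ∃ (x : ℝ → E2) (z1 z2 : ℝ → ℝ),
        IsSolution c x z1 z2 ∧ initNorm x z1 z2 ≤ 2 ∧
        1 ≤ Xnorm x z1 z2 T := by
  refine ⟨20, by norm_num, fun T hT => ?_⟩
  obtain ⟨S, hS0, hS⟩ : ∃ S : ℝ, 0 ≤ S ∧ 3 * (2 + 60 * T) ≤ 0.13 * S :=
    ⟨30 * (2 + 60 * T), by positivity, by linarith⟩
  set W : ℝ → ℝ := fun s => (1 - Real.sin (2 * s)) / 2 * phi (S + 1 - s) with hWdef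
  set V : ℝ → ℝ := fun s => phi (S + 2 - s) with hVdef
  have hWc : Continuous W := by
    have := continuous_phi.comp (g := phi) (f := fun s : ℝ => S + 1 - s) (by fun_prop)
    exact (by fun_prop : Continuous fun s => (1 - Real.sin (2 * s)) / 2).mul this
  have hVc : Continuous V := continuous_phi.comp (f := fun s : ℝ => S + 2 - s) (by fun_prop)
  have hW0 : ∀ s, 0 ≤ W s := fun s =>
    mul_nonneg (by linarith [Real.sin_le_one (2 * s)]) (phi_nonneg _)
  have hW1 : ∀ s, W s ≤ 1 := fun s =>
    mul_le_one₀ (by linarith [Real.neg_one_le_sin (2 * s)]) (phi_nonneg _) (phi_le_one _)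
  have hVone : ∀ s, s ≤ S + 1 → V s = 1 := fun s hs => phi_of_one_le (by linarith)
  have hWzero : ∀ s, S + 1 ≤ s → W s = 0 := fun s hs => by
    simp only [hWdef, phi_of_nonpos (by linarith : S + 1 - s ≤ 0), mul_zero]
  have hVzero : ∀ s, S + 2 ≤ s → V s = 0 := fun s hs => phi_of_nonpos (by linarith)
  have hω : ∀ s, 0.4 ≤ angularRate (W s) s := fun s => angularRate_ge (hW0 s) (hW1 s)
  set ρ : ℝ → ℝ := fun s => 0.1 + ∫ r in (0 : ℝ)..s, radialRate (W r) r / angularRate (W r) r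
    with hρdef
  have hρ : ∀ s, HasDerivAt ρ (radialRate (W s) s / angularRate (W s) s) s := fun s =>
    (hasDerivAt_integral_of_continuous ((continuous_radialRate hWc).div
      (continuous_angularRate hWc) fun s => by linarith [hω s]) 0 s).const_add _
  have hρc : Continuous ρ := continuous_iff_continuousAt.2 fun s => (hρ s).continuousAt
  have hρ0 : ρ 0 = 0.1 := by simp [hρdef]
  have hgrow : ∀ s, 0 ≤ s → s ≤ S → 0.13 * s ≤ ρ s := fun s hs hsS => by
    have hd : ∀ r : ℝ, HasDerivAt (fun r => 0.13 * r - 0.055 * Real.sin (4 * r))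
        (0.13 - 0.22 * Real.cos (4 * r)) r := fun r => by
      have h := ((hasDerivAt_id r).const_mul 0.13).sub
        (((hasDerivAt_id r).const_mul 4).sin.const_mul 0.055)
      refine h.congr_deriv ?_
      simp only [id]
      ring
    have h := sub_le_sub_of_hasDerivAt_le hs (fun r _ => hd r) (fun r _ => hρ r) fun r hr => by
      have : W r = (1 - Real.sin (2 * r)) / 2 := by
        simp only [hWdef, phi_of_one_le (by linarith [hr.2] : 1 ≤ S + 1 - r), mul_one]
      rw [this]
      exact growth_le_radialRate_div r
    simp only [hρ0, mul_zero, Real.sin_zero] at h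
    linarith [Real.sin_le_one (4 * s)]
  have hdecay : ∀ s, S ≤ s → 0.13 * S - 3 * (s - S) ≤ ρ s := fun s hs => by
    have h := sub_le_sub_of_hasDerivAt_le hs
      (fun r _ => ((hasDerivAt_id r).const_mul (-3)).congr_deriv (mul_one (-3)))
      (fun r _ => hρ r) fun r _ => neg_three_le_radialRate_div (hW0 r) (hW1 r)
    simp only [id] at h
    linarith [hgrow S hS0 le_rfl]
  have hspeed : ∀ s, 8 * (1 + V s * Real.exp (2 * ρ s)) ≤ spiralSpeed 20 W V ρ s := fun s => by
    have := phi_nonneg (S + 2 - s)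
    exact mul_le_mul_of_nonneg_right (by linarith [hω s]) (by positivity)
  have hspeed8 : ∀ s, 8 ≤ spiralSpeed 20 W V ρ s := fun s => by
    have : 0 ≤ V s * Real.exp (2 * ρ s) := mul_nonneg (phi_nonneg _) (Real.exp_pos _).le
    linarith [hspeed s]
  set τ : ℝ → ℝ := fun s => ∫ r in (0 : ℝ)..s, (spiralSpeed 20 W V ρ (max r 0))⁻¹ with hτdef
  have hτ : ∀ s, HasDerivAt τ (spiralSpeed 20 W V ρ (max s 0))⁻¹ s := fun s => by
    have hcont : Continuous (spiralSpeed 20 W V ρ) := by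
      have := continuous_angularRate hWc
      unfold spiralSpeed
      fun_prop
    exact hasDerivAt_integral_of_continuous
      ((hcont.comp (by fun_prop : Continuous fun r : ℝ => max r 0)).inv₀
        fun r => ne_of_gt (lt_of_lt_of_le (by norm_num) (hspeed8 (max r 0)))) 0 s
  have hτ0 : τ 0 = 0 := by simp [hτdef]
  have hτS : τ S ≤ 1 / 2 := by
    have hd : ∀ r : ℝ, HasDerivAt (fun r => -(1 / 2) * Real.exp (-0.26 * r))
        (0.13 * Real.exp (-0.26 * r)) r := fun r => by
      have h := (((hasDerivAt_id r).const_mul (-0.26)).exp).const_mul (-(1 / 2))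
      refine h.congr_deriv ?_
      simp only [id]
      ring
    have h := sub_le_sub_of_hasDerivAt_le hS0 (fun r _ => hτ r) (fun r _ => hd r) fun r hr => by
      have h1 : Real.exp (0.26 * r) ≤ Real.exp (2 * ρ r) :=
        Real.exp_le_exp.2 (by linarith [hgrow r hr.1 hr.2])
      have h2 := hspeed r
      rw [hVone r (by linarith [hr.2]), one_mul] at h2
      rw [max_eq_left hr.1, show -0.26 * r = -(0.26 * r) by ring, Real.exp_neg]
      calc (spiralSpeed 20 W V ρ r)⁻¹ ≤ (8 * Real.exp (0.26 * r))⁻¹ :=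
            inv_anti₀ (by positivity) (by linarith)
        _ = 0.125 * (Real.exp (0.26 * r))⁻¹ := by rw [mul_inv]; norm_num
        _ ≤ 0.13 * (Real.exp (0.26 * r))⁻¹ := by gcongr; norm_num
    simp only [hτ0, mul_zero, Real.exp_zero] at h
    linarith [Real.exp_pos (-0.26 * S)]
  have hτb : τ (S + 2) ≤ 1 := by
    have h := sub_le_sub_of_hasDerivAt_le (by linarith : S ≤ S + 2) (fun r _ => hτ r)
      (fun r _ => ((hasDerivAt_id r).const_mul (1 / 8)).congr_deriv (mul_one (1 / 8)))
      fun r _ => (inv_anti₀ (by norm_num) (hspeed8 _)).trans (by norm_num)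
    simp only [id] at h
    linarith
  have hτpos : ∀ s, 0 ≤ s → 0 ≤ τ s := fun s hs => by
    have h := sub_le_sub_of_hasDerivAt_le hs (fun r _ => hasDerivAt_const r (0 : ℝ))
      (fun r _ => hτ r) fun r _ => inv_nonneg.2 (by linarith [hspeed8 (max r 0)])
    linarith
  have hτge : ∀ s, S + 2 ≤ s → (s - (S + 2)) / 60 ≤ τ s := fun s hs => by
    have h := sub_le_sub_of_hasDerivAt_le hs
      (fun r _ => ((hasDerivAt_id r).const_mul (1 / 60)).congr_deriv (mul_one (1 / 60)))
      (fun r _ => hτ r) fun r hr => by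
        have hr0 : 0 ≤ r := by linarith [hr.1]
        rw [max_eq_left hr0, one_div]
        refine inv_anti₀ (by linarith [hspeed8 r]) ?_
        rw [spiralSpeed, hVzero r hr.1]
        linarith [angularRate_le (s := r) (hW0 r) (hW1 r)]
    simp only [id] at h
    linarith [hτpos (S + 2) (by linarith)]
  obtain ⟨x, z1, z2, hsol, hinit, hx⟩ := exists_solution_of_spiral (c := 20) (b := S + 2)
    (by norm_num) hWc hVc hW0 hW1 (fun _ => phi_nonneg _) (fun _ => phi_le_one _)
    (fun s => (le_total s (S + 1)).imp (hVone s) (hWzero s))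
    (fun s hs => hWzero s (by linarith)) hVzero hρ
    (by
      rw [hρ0]
      rw [← Real.le_log_iff_exp_le (by norm_num)]
      linarith [Real.log_two_gt_d9]) hτ0 hτ hτb
  refine ⟨x, z1, z2, hsol, hinit, ?_⟩
  obtain ⟨s, hs0, hsT, hxs⟩ := hx T hT
  have hρs : 0 ≤ ρ s := by
    rcases le_total s S with hsS | hsS
    · linarith [hgrow s hs0 hsS]
    · have hsle : s ≤ S + 2 + 60 * T := by
        rcases le_total s (S + 2) with h | h
        · linarith
        · linarith [hτge s h]
      linarith [hdecay s hsS]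
  rw [Xnorm, hxs, Real.one_le_sqrt]
  have := Real.one_le_exp (by linarith : 0 ≤ 2 * ρ s)
  linarith [sq_nonneg (z1 T), sq_nonneg (z2 T)]
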